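/- Consistency of the control discretization: under Assumption (A), fix ε ∈ (0,1), φ ∈ C^{1,2}([0,T]×ℝ^d), and a family (A_δ)_{δ∈(0,1]} of finite nonempty subsets of A with sup_{α∈A} min_{α'∈A_δ} |α−α'| < δ for every δ ∈ (0,1]. For ξ = (t,x) ∈ (0,T]×ℝ^d, r ∈ ℝ and a nonempty A' ⊆ A define F^{A'}[φ,r](ξ) := min{ φ(ξ) + r − ζ(ξ), ∂_tφ(ξ) + inf_{α∈A'}( −L_ε^αφ(ξ) − f(α,t,x,φ(ξ)+r, σ̃(α,x)ᵀ Dφ(ξ), B_ε^αφ(ξ)) ) }. Then there exist functions ω₁ : ((0,T]×ℝ^d)×(0,1] → [0,∞) and ω₂ : ℝ → [0,∞) such that ω₁(ξ,δ) → 0 as δ → 0 for every ξ, ω₂(r) → 0 as r → 0, ω₁(·,δ) is Lipschitz continuous on every compact subset of (0,T]×ℝ^d with a Lipschitz constant independent of δ ∈ (0,1], and | F^{A}[φ,0](ξ) − F^{A_δ}[φ,r](ξ) | ≤ ω₁(ξ,δ) + ω₂(r) for all ξ ∈ (0,T]×ℝ^d, δ ∈ (0,1] and r ∈ ℝ. 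-/

import Mathlib

open MeasureTheory Set Filter Topology Metric
open scoped RealInnerProductSpace Matrix

attribute [local instance] Matrix.normedAddCommGroup Matrix.normedSpace

noncomputable section

abbrev Vec (d : ℕ) := EuclideanSpace ℝ (Fin d)

structure C12 (d : ℕ) where
  toFun : ℝ → Vec d → ℝ
  dt : ℝ → Vec d → ℝ
  grad : ℝ → Vec d → Vec d
  hess : ℝ → Vec d → Matrix (Fin d) (Fin d) ℝ
  hasDt : ∀ t x, HasDerivAt (fun s => toFun s x) (dt t x) t
  hasGrad : ∀ t x, HasGradientAt (toFun t) (grad t x) x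
  hasHess : ∀ t x, HasFDerivAt (grad t)
      ((Matrix.toEuclideanLin (hess t x)).toContinuousLinearMap) x
  cont : Continuous fun p : ℝ × Vec d => toFun p.1 p.2
  cont_dt : Continuous fun p : ℝ × Vec d => dt p.1 p.2
  cont_grad : Continuous fun p : ℝ × Vec d => grad p.1 p.2
  cont_hess : Continuous fun p : ℝ × Vec d => hess p.1 p.2

def mvE {d : ℕ} (M : Matrix (Fin d) (Fin d) ℝ) (v : Vec d) : Vec d :=
  (EuclideanSpace.equiv (Fin d) ℝ).symm (M.mulVec ((EuclideanSpace.equiv (Fin d) ℝ) v))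

variable {n d m : ℕ}

/-- Assumption (A) of the paper. -/
structure AssumptionA (ν : Measure (Vec n)) (A : Set (Vec m)) (T : ℝ)
    (b : Vec m → Vec d → Vec d) (σ : Vec m → Vec d → Matrix (Fin d) (Fin d) ℝ)
    (η : Vec m → Vec d → Vec n → Vec d) (γ : Vec d → Vec n → ℝ)
    (f : Vec m → ℝ → Vec d → ℝ → Vec d → ℝ → ℝ)
    (ζ : ℝ → Vec d → ℝ) (g : Vec d → ℝ) (C : ℝ) : Prop where
  hC : 0 < C
  hT : 0 < T
  hAcpt : IsCompact A
  hAne : A.Nonempty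
  hν_sf : SigmaFinite ν
  hν_zero : ν {0} = 0
  hν_int : Integrable (fun e => min 1 (‖e‖ ^ 2)) ν
  hη_meas : ∀ α x, Measurable (η α x)
  hγ_meas : ∀ x, Measurable (γ x)
  hb : ∀ α ∈ A, ∀ α' ∈ A, ∀ x x' : Vec d,
      ‖b α x - b α' x'‖ + ‖σ α x - σ α' x'‖ ≤ C * (‖x - x'‖ + ‖α - α'‖)
  hη_lip : ∀ α ∈ A, ∀ α' ∈ A, ∀ (x x' : Vec d) (e : Vec n),
      ‖η α x e - η α' x' e‖ ≤ C * (‖x - x'‖ + ‖α - α'‖) * min 1 ‖e‖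
  hη_bdd : ∀ α ∈ A, ∀ (x : Vec d) (e : Vec n), ‖η α x e‖ ≤ C * min 1 ‖e‖
  hγ_lip : ∀ (x x' : Vec d) (e : Vec n),
      |γ x e - γ x' e| ≤ C * ‖x - x'‖ * min 1 (‖e‖ ^ 2)
  hγ_nonneg : ∀ x e, 0 ≤ γ x e
  hγ_bdd : ∀ (x : Vec d) (e : Vec n), γ x e ≤ C * min 1 ‖e‖
  hf_t_cont : ∀ α x u p k, Continuous fun t => f α t x u p k
  hf_bdd : ∀ α ∈ A, ∀ t ∈ Icc (0:ℝ) T, ∀ x : Vec d, |f α t x 0 0 0| ≤ C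
  hf_mono : ∀ α ∈ A, ∀ t ∈ Icc (0:ℝ) T, ∀ (x : Vec d) (p : Vec d) (k u v : ℝ),
      v ≤ u → C * (u - v) ≤ f α t x v p k - f α t x u p k
  hf_k_mono : ∀ α ∈ A, ∀ t ∈ Icc (0:ℝ) T, ∀ (x : Vec d) (u : ℝ) (p : Vec d),
      Monotone fun k => f α t x u p k
  hf_lip : ∀ α ∈ A, ∀ α' ∈ A, ∀ t ∈ Icc (0:ℝ) T, ∀ (x : Vec d) (u v : ℝ) (p q : Vec d) (k k' : ℝ),
      |f α t x u p k - f α' t x v q k'| ≤ C * (‖α - α'‖ + |u - v| + ‖p - q‖ + |k - k'|)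
  hf_x : ∀ R > (0:ℝ), ∃ mR : ℝ → ℝ, Continuous mR ∧ mR 0 = 0 ∧ (∀ r, 0 ≤ mR r) ∧
      ∀ α ∈ A, ∀ t ∈ Icc (0:ℝ) T, ∀ (x x' : Vec d) (u : ℝ) (p : Vec d) (k : ℝ),
        ‖x‖ ≤ R → ‖x'‖ ≤ R → |u| ≤ R →
        |f α t x u p k - f α t x' u p k| ≤ mR (‖x - x'‖ * (1 + ‖p‖))
  hζ_t_cont : ∀ x, Continuous fun t => ζ t x
  hζg_lip : ∀ (t : ℝ) (x x' : Vec d), |g x - g x'| + |ζ t x - ζ t x'| ≤ C * ‖x - x'‖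
  hζg_bdd : ∀ (t : ℝ) (x : Vec d), |g x| + |ζ t x| ≤ C
  hgζ : ∀ x, ζ 0 x ≤ g x

/-- The nonlocal operator `K^α`. -/
def Kop (ν : Measure (Vec n)) (η : Vec m → Vec d → Vec n → Vec d)
    (φ : C12 d) (α : Vec m) (t : ℝ) (x : Vec d) : ℝ :=
  ∫ e, (φ.toFun t (x + η α x e) - φ.toFun t x - ⟪η α x e, φ.grad t x⟫) ∂ν

/-- The nonlocal operator `B^α`. -/
def Bop (ν : Measure (Vec n)) (η : Vec m → Vec d → Vec n → Vec d) (γ : Vec d → Vec n → ℝ)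
    (φ : C12 d) (α : Vec m) (t : ℝ) (x : Vec d) : ℝ :=
  ∫ e, (φ.toFun t (x + η α x e) - φ.toFun t x) * γ x e ∂ν

/-- The local operator `A^α`. -/
def Aop (b : Vec m → Vec d → Vec d) (σ : Vec m → Vec d → Matrix (Fin d) (Fin d) ℝ)
    (φ : C12 d) (α : Vec m) (t : ℝ) (x : Vec d) : ℝ :=
  (1/2) * Matrix.trace (σ α x * (σ α x)ᵀ * φ.hess t x) + ⟪b α x, φ.grad t x⟫

/-- `L^α = A^α + K^α`. -/
def Lop (ν : Measure (Vec n)) (b : Vec m → Vec d → Vec d)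
    (σ : Vec m → Vec d → Matrix (Fin d) (Fin d) ℝ) (η : Vec m → Vec d → Vec n → Vec d)
    (φ : C12 d) (α : Vec m) (t : ℝ) (x : Vec d) : ℝ :=
  Aop b σ φ α t x + Kop ν η φ α t x

/-- Modified diffusion matrix `σ̃`. -/
def sigmaTilde (ν : Measure (Vec n)) (σ : Vec m → Vec d → Matrix (Fin d) (Fin d) ℝ)
    (η : Vec m → Vec d → Vec n → Vec d) (ε : ℝ) (α : Vec m) (x : Vec d) :
    Matrix (Fin d) (Fin d) ℝ :=
  Matrix.of fun i j =>
    if i = j then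
      Real.sqrt ((σ α x i i) ^ 2 + ∫ e in {e : Vec n | ‖e‖ < ε}, (η α x e i) ^ 2 ∂ν)
    else σ α x i j

/-- Truncated `K_ε^α`. -/
def Ktr (ν : Measure (Vec n)) (η : Vec m → Vec d → Vec n → Vec d) (ε : ℝ)
    (φ : C12 d) (α : Vec m) (t : ℝ) (x : Vec d) : ℝ :=
  Kop (ν.restrict {e : Vec n | ε < ‖e‖}) η φ α t x

/-- Truncated `B_ε^α`. -/
def Btr (ν : Measure (Vec n)) (η : Vec m → Vec d → Vec n → Vec d) (γ : Vec d → Vec n → ℝ)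
    (ε : ℝ) (φ : C12 d) (α : Vec m) (t : ℝ) (x : Vec d) : ℝ :=
  Bop (ν.restrict {e : Vec n | ε < ‖e‖}) η γ φ α t x

/-- Truncated `L_ε^α`. -/
def Ltr (ν : Measure (Vec n)) (b : Vec m → Vec d → Vec d)
    (σ : Vec m → Vec d → Matrix (Fin d) (Fin d) ℝ) (η : Vec m → Vec d → Vec n → Vec d)
    (ε : ℝ) (φ : C12 d) (α : Vec m) (t : ℝ) (x : Vec d) : ℝ :=
  (1/2) * Matrix.trace (sigmaTilde ν σ η ε α x * (sigmaTilde ν σ η ε α x)ᵀ * φ.hess t x)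
    + ⟪b α x, φ.grad t x⟫ + Ktr ν η ε φ α t x

/-- Viscosity subsolution of the HJBVI
`min{ u − ζ, ∂ₜu + inf_{α∈A}( −L^α u − f(α,t,x,u,σᵀDu,B^α u) ) } = 0`. -/
def SubsolnHJBVI (ν : Measure (Vec n)) (A : Set (Vec m)) (T : ℝ)
    (b : Vec m → Vec d → Vec d) (σ : Vec m → Vec d → Matrix (Fin d) (Fin d) ℝ)
    (η : Vec m → Vec d → Vec n → Vec d) (γ : Vec d → Vec n → ℝ)
    (f : Vec m → ℝ → Vec d → ℝ → Vec d → ℝ → ℝ) (ζ : ℝ → Vec d → ℝ)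
    (u : ℝ → Vec d → ℝ) : Prop :=
  ∀ (φ : C12 d) (t₀ : ℝ) (x₀ : Vec d), t₀ ∈ Ioc (0:ℝ) T →
    (∀ t ∈ Icc (0:ℝ) T, ∀ x, u t x - φ.toFun t x ≤ u t₀ x₀ - φ.toFun t₀ x₀) →
    min (u t₀ x₀ - ζ t₀ x₀)
      (φ.dt t₀ x₀ + ⨅ α : A, (-(Lop ν b σ η φ (↑α) t₀ x₀)
        - f (↑α) t₀ x₀ (u t₀ x₀) (mvE ((σ (↑α) x₀)ᵀ) (φ.grad t₀ x₀))
            (Bop ν η γ φ (↑α) t₀ x₀))) ≤ 0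

/-- Viscosity supersolution of the HJBVI. -/
def SupersolnHJBVI (ν : Measure (Vec n)) (A : Set (Vec m)) (T : ℝ)
    (b : Vec m → Vec d → Vec d) (σ : Vec m → Vec d → Matrix (Fin d) (Fin d) ℝ)
    (η : Vec m → Vec d → Vec n → Vec d) (γ : Vec d → Vec n → ℝ)
    (f : Vec m → ℝ → Vec d → ℝ → Vec d → ℝ → ℝ) (ζ : ℝ → Vec d → ℝ)
    (u : ℝ → Vec d → ℝ) : Prop :=
  ∀ (φ : C12 d) (t₀ : ℝ) (x₀ : Vec d), t₀ ∈ Ioc (0:ℝ) T →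
    (∀ t ∈ Icc (0:ℝ) T, ∀ x, u t₀ x₀ - φ.toFun t₀ x₀ ≤ u t x - φ.toFun t x) →
    0 ≤ min (u t₀ x₀ - ζ t₀ x₀)
      (φ.dt t₀ x₀ + ⨅ α : A, (-(Lop ν b σ η φ (↑α) t₀ x₀)
        - f (↑α) t₀ x₀ (u t₀ x₀) (mvE ((σ (↑α) x₀)ᵀ) (φ.grad t₀ x₀))
            (Bop ν η γ φ (↑α) t₀ x₀)))

/-- Viscosity subsolution of the `A'`-HJBVI with `ε`-truncated operators. -/
def SubsolnHJBVIe (ν : Measure (Vec n)) (A' : Set (Vec m)) (T : ℝ)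
    (b : Vec m → Vec d → Vec d) (σ : Vec m → Vec d → Matrix (Fin d) (Fin d) ℝ)
    (η : Vec m → Vec d → Vec n → Vec d) (γ : Vec d → Vec n → ℝ)
    (f : Vec m → ℝ → Vec d → ℝ → Vec d → ℝ → ℝ) (ζ : ℝ → Vec d → ℝ) (ε : ℝ)
    (u : ℝ → Vec d → ℝ) : Prop :=
  ∀ (φ : C12 d) (t₀ : ℝ) (x₀ : Vec d), t₀ ∈ Ioc (0:ℝ) T →
    (∀ t ∈ Icc (0:ℝ) T, ∀ x, u t x - φ.toFun t x ≤ u t₀ x₀ - φ.toFun t₀ x₀) →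
    min (u t₀ x₀ - ζ t₀ x₀)
      (φ.dt t₀ x₀ + ⨅ α : A', (-(Ltr ν b σ η ε φ (↑α) t₀ x₀)
        - f (↑α) t₀ x₀ (u t₀ x₀) (mvE ((sigmaTilde ν σ η ε (↑α) x₀)ᵀ) (φ.grad t₀ x₀))
            (Btr ν η γ ε φ (↑α) t₀ x₀))) ≤ 0

/-- Viscosity supersolution of the `A'`-HJBVI with `ε`-truncated operators. -/
def SupersolnHJBVIe (ν : Measure (Vec n)) (A' : Set (Vec m)) (T : ℝ)
    (b : Vec m → Vec d → Vec d) (σ : Vec m → Vec d → Matrix (Fin d) (Fin d) ℝ)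
    (η : Vec m → Vec d → Vec n → Vec d) (γ : Vec d → Vec n → ℝ)
    (f : Vec m → ℝ → Vec d → ℝ → Vec d → ℝ → ℝ) (ζ : ℝ → Vec d → ℝ) (ε : ℝ)
    (u : ℝ → Vec d → ℝ) : Prop :=
  ∀ (φ : C12 d) (t₀ : ℝ) (x₀ : Vec d), t₀ ∈ Ioc (0:ℝ) T →
    (∀ t ∈ Icc (0:ℝ) T, ∀ x, u t₀ x₀ - φ.toFun t₀ x₀ ≤ u t x - φ.toFun t x) →
    0 ≤ min (u t₀ x₀ - ζ t₀ x₀)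
      (φ.dt t₀ x₀ + ⨅ α : A', (-(Ltr ν b σ η ε φ (↑α) t₀ x₀)
        - f (↑α) t₀ x₀ (u t₀ x₀) (mvE ((sigmaTilde ν σ η ε (↑α) x₀)ᵀ) (φ.grad t₀ x₀))
            (Btr ν η γ ε φ (↑α) t₀ x₀)))

/-- The switching obstacle `M_j U = max_{k ≠ j} (U_k − c)`. -/
def MaxSw {J : ℕ} (U : Fin J → ℝ → Vec d → ℝ) (c : ℝ) (j : Fin J) (t : ℝ) (x : Vec d) : ℝ :=
  ⨆ k : {k : Fin J // k ≠ j}, (U (↑k) t x - c)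

/-- Viscosity subsolution of the switching system. -/
def SubsolnSwitch (ν : Measure (Vec n)) (T : ℝ)
    (b : Vec m → Vec d → Vec d) (σ : Vec m → Vec d → Matrix (Fin d) (Fin d) ℝ)
    (η : Vec m → Vec d → Vec n → Vec d) (γ : Vec d → Vec n → ℝ)
    (f : Vec m → ℝ → Vec d → ℝ → Vec d → ℝ → ℝ) (ζ : ℝ → Vec d → ℝ) (ε : ℝ)
    {J : ℕ} (αs : Fin J → Vec m) (c : ℝ) (U : Fin J → ℝ → Vec d → ℝ) : Prop :=
  ∀ (j : Fin J) (φ : C12 d) (t₀ : ℝ) (x₀ : Vec d), t₀ ∈ Ioc (0:ℝ) T →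
    (∀ t ∈ Icc (0:ℝ) T, ∀ x, U j t x - φ.toFun t x ≤ U j t₀ x₀ - φ.toFun t₀ x₀) →
    min (U j t₀ x₀ - ζ t₀ x₀)
      (min (φ.dt t₀ x₀ - Ltr ν b σ η ε φ (αs j) t₀ x₀
          - f (αs j) t₀ x₀ (U j t₀ x₀)
              (mvE ((sigmaTilde ν σ η ε (αs j) x₀)ᵀ) (φ.grad t₀ x₀))
              (Btr ν η γ ε φ (αs j) t₀ x₀))
        (U j t₀ x₀ - MaxSw U c j t₀ x₀)) ≤ 0

/-- Viscosity supersolution of the switching system. -/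
def SupersolnSwitch (ν : Measure (Vec n)) (T : ℝ)
    (b : Vec m → Vec d → Vec d) (σ : Vec m → Vec d → Matrix (Fin d) (Fin d) ℝ)
    (η : Vec m → Vec d → Vec n → Vec d) (γ : Vec d → Vec n → ℝ)
    (f : Vec m → ℝ → Vec d → ℝ → Vec d → ℝ → ℝ) (ζ : ℝ → Vec d → ℝ) (ε : ℝ)
    {J : ℕ} (αs : Fin J → Vec m) (c : ℝ) (U : Fin J → ℝ → Vec d → ℝ) : Prop :=
  ∀ (j : Fin J) (φ : C12 d) (t₀ : ℝ) (x₀ : Vec d), t₀ ∈ Ioc (0:ℝ) T →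
    (∀ t ∈ Icc (0:ℝ) T, ∀ x, U j t₀ x₀ - φ.toFun t₀ x₀ ≤ U j t x - φ.toFun t x) →
    0 ≤ min (U j t₀ x₀ - ζ t₀ x₀)
      (min (φ.dt t₀ x₀ - Ltr ν b σ η ε φ (αs j) t₀ x₀
          - f (αs j) t₀ x₀ (U j t₀ x₀)
              (mvE ((sigmaTilde ν σ η ε (αs j) x₀)ᵀ) (φ.grad t₀ x₀))
              (Btr ν η γ ε φ (αs j) t₀ x₀))
        (U j t₀ x₀ - MaxSw U c j t₀ x₀))

/-- The operator `F^{A'}[φ,r](ξ)` of STATEMENT 5. -/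
def Fop (ν : Measure (Vec n)) (A' : Set (Vec m))
    (b : Vec m → Vec d → Vec d) (σ : Vec m → Vec d → Matrix (Fin d) (Fin d) ℝ)
    (η : Vec m → Vec d → Vec n → Vec d) (γ : Vec d → Vec n → ℝ)
    (f : Vec m → ℝ → Vec d → ℝ → Vec d → ℝ → ℝ) (ζ : ℝ → Vec d → ℝ) (ε : ℝ)
    (φ : C12 d) (r : ℝ) (t : ℝ) (x : Vec d) : ℝ :=
  min (φ.toFun t x + r - ζ t x)
    (φ.dt t x + ⨅ α : A', (-(Ltr ν b σ η ε φ (↑α) t x)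
      - f (↑α) t x (φ.toFun t x + r)
          (mvE ((sigmaTilde ν σ η ε (↑α) x)ᵀ) (φ.grad t x))
          (Btr ν η γ ε φ (↑α) t x)))

lemma min_one_sq_le (r : ℝ) (hr : 0 ≤ r) : (min 1 r) ^ 2 ≤ min 1 (r ^ 2) := by
  have h0 : 0 ≤ min 1 r := le_min zero_le_one hr
  refine le_min ?_ (pow_le_pow_left₀ h0 (min_le_right _ _) 2)
  exact pow_le_one₀ h0 (min_le_left _ _)

lemma abs_sqrt_sub_sqrt_le_sqrt_abs_sub {u v : ℝ} (hu : 0 ≤ u) (hv : 0 ≤ v) :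
    |√u - √v| ≤ √|u - v| := by
  refine Real.le_sqrt_of_sq_le ?_
  have h : u - v = (√u - √v) * (√u + √v) := by
    nlinarith [Real.sq_sqrt hu, Real.sq_sqrt hv]
  have hs : |√u - √v| ≤ √u + √v := by
    rw [abs_le]; constructor <;> linarith [Real.sqrt_nonneg u, Real.sqrt_nonneg v]
  rw [h, abs_mul, abs_of_nonneg (add_nonneg (Real.sqrt_nonneg u) (Real.sqrt_nonneg v)), sq]
  gcongr

lemma abs_trace_mul_transpose_mul_sub_le {M M' H : Matrix (Fin d) (Fin d) ℝ} {S D Q : ℝ}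
    (hM : ∀ i j, |M i j| ≤ S) (hM' : ∀ i j, |M' i j| ≤ S)
    (hD : ∀ i j, |M i j - M' i j| ≤ D) (hH : ∀ i j, |H i j| ≤ Q) :
    |(M * Mᵀ * H).trace - (M' * M'ᵀ * H).trace| ≤ d ^ 3 * (2 * S * D * Q) := by
  have key : (M * Mᵀ * H).trace - (M' * M'ᵀ * H).trace
      = ∑ i, ∑ j, ∑ k, (M i k * M j k - M' i k * M' j k) * H j i := by
    simp only [Matrix.trace, Matrix.diag_apply, Matrix.mul_apply, Matrix.transpose_apply,
      ← Finset.sum_sub_distrib, ← sub_mul, Finset.sum_mul]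
  have term : ∀ i j k, |(M i k * M j k - M' i k * M' j k) * H j i| ≤ 2 * S * D * Q := by
    intro i j k
    have hS : 0 ≤ S := (abs_nonneg _).trans (hM i k)
    have hD0 : 0 ≤ D := (abs_nonneg _).trans (hD i k)
    have h : |M i k * M j k - M' i k * M' j k| ≤ 2 * S * D := by
      have e : M i k * M j k - M' i k * M' j k
          = M i k * (M j k - M' j k) + (M i k - M' i k) * M' j k := by ring
      calc _ ≤ |M i k| * |M j k - M' j k| + |M i k - M' i k| * |M' j k| := by
            rw [e, ← abs_mul, ← abs_mul]; exact abs_add_le _ _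
        _ ≤ S * D + D * S := by gcongr <;> first | apply hM | apply hM' | apply hD
        _ = _ := by ring
    rw [abs_mul]
    gcongr
    exact hH j i
  rw [key]
  calc _ ≤ ∑ i : Fin d, ∑ j : Fin d, ∑ k : Fin d, 2 * S * D * Q := by
        refine (Finset.abs_sum_le_sum_abs _ _).trans (Finset.sum_le_sum fun i _ => ?_)
        refine (Finset.abs_sum_le_sum_abs _ _).trans (Finset.sum_le_sum fun j _ => ?_)
        exact (Finset.abs_sum_le_sum_abs _ _).trans (Finset.sum_le_sum fun k _ => term i j k)
    _ = _ := by
        simp only [Finset.sum_const, Finset.card_univ, Fintype.card_fin, nsmul_eq_mul]; ring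

lemma norm_mvE_sub_le {M M' : Matrix (Fin d) (Fin d) ℝ} {D : ℝ}
    (hD : ∀ i j, |M i j - M' i j| ≤ D) (v : Vec d) :
    ‖mvE M v - mvE M' v‖ ≤ d ^ 2 * (D * ‖v‖) := by
  have coord : ∀ i, |(mvE M v - mvE M' v) i| ≤ d * (D * ‖v‖) := by
    intro i
    have e : (mvE M v - mvE M' v) i = ∑ j, (M i j - M' i j) * v j := by
      simp [mvE, Matrix.mulVec, dotProduct, sub_mul, Finset.sum_sub_distrib]
    rw [e]
    calc _ ≤ ∑ j : Fin d, D * ‖v‖ := by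
          refine (Finset.abs_sum_le_sum_abs _ _).trans (Finset.sum_le_sum fun j _ => ?_)
          rw [abs_mul]
          have hD0 : 0 ≤ D := (abs_nonneg _).trans (hD i j)
          gcongr
          · exact hD i j
          · exact PiLp.norm_apply_le v j
      _ = _ := by simp
  rw [← (EuclideanSpace.basisFun (Fin d) ℝ).sum_repr (mvE M v - mvE M' v)]
  calc _ ≤ ∑ i : Fin d, (d : ℝ) * (D * ‖v‖) := by
        refine norm_sum_le_of_le _ fun i _ => ?_
        rw [norm_smul, OrthonormalBasis.norm_eq_one, mul_one]
        exact coord i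
    _ = _ := by simp; ring

lemma abs_iInf_sub_iInf_le {ι : Type*} {A A' : Set ι} {h h' : ι → ℝ} {c B : ℝ}
    (hA' : A'.Nonempty) (hsub : A' ⊆ A) (hB : ∀ α ∈ A, B ≤ h α)
    (hle : ∀ α ∈ A', |h α - h' α| ≤ c) (happrox : ∀ α ∈ A, ∃ α' ∈ A', |h α - h' α'| ≤ c) :
    |(⨅ α : A, h α) - ⨅ α : A', h' α| ≤ c := by
  have hbdd : BddBelow (range fun α : A => h α) := ⟨B, by rintro _ ⟨α, rfl⟩; exact hB α α.2⟩
  have hbdd' : BddBelow (range fun α : A' => h' α) := by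
    refine ⟨B - c, ?_⟩
    rintro _ ⟨α, rfl⟩
    have h1 := hB α (hsub α.2)
    have h2 := (abs_le.1 (hle α α.2)).2
    dsimp only
    linarith
  have : Nonempty A' := hA'.to_subtype
  have : Nonempty A := (hA'.mono hsub).to_subtype
  rw [abs_sub_le_iff]
  constructor
  · rw [sub_le_iff_le_add, ← sub_le_iff_le_add']
    refine le_ciInf fun α => ?_
    have h1 := ciInf_le hbdd ⟨α, hsub α.2⟩
    have h2 := (abs_le.1 (hle α α.2)).2
    dsimp only at h1
    linarith
  · rw [sub_le_iff_le_add, ← sub_le_iff_le_add']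
    refine le_ciInf fun α => ?_
    obtain ⟨α', hα', h2⟩ := happrox α α.2
    have h1 := ciInf_le hbdd' ⟨α', hα'⟩
    have h2 := (abs_le.1 h2).1
    dsimp only at h1
    linarith

/-- A function of `x` that is only required to lie in convex sets which have a common point
locally uniformly can be chosen locally Lipschitz. -/
lemma exists_locallyLipschitz_forall_mem {t : Vec d → Set ℝ} (ht : ∀ x, Convex ℝ (t x))
    (hloc : ∀ R : ℝ, ∃ c, ∀ x, ‖x‖ ≤ R → c ∈ t x) :
    ∃ W : Vec d → ℝ, LocallyLipschitz W ∧ ∀ x, W x ∈ t x := by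
  obtain ⟨W, hW⟩ := exists_contMDiffMap_forall_mem_convex_of_local_const
    (n := 1) (modelWithCornersSelf ℝ (Vec d)) ht fun x => by
      obtain ⟨c, hc⟩ := hloc (‖x‖ + 1)
      refine ⟨c, ?_⟩
      filter_upwards [continuous_norm.continuousAt.eventually_lt_const (lt_add_one ‖x‖)]
        with y hy using hc y hy.le
  exact ⟨W, (contMDiff_iff_contDiff.1 W.contMDiff).locallyLipschitz (𝕂 := ℝ), hW⟩

lemma exists_forall_norm_le_of_continuous {G : Type*} [SeminormedAddCommGroup G]
    {h : ℝ × Vec d → G} (hh : Continuous h) (T R : ℝ) :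
    ∃ P, 0 ≤ P ∧ ∀ t ∈ Icc (0:ℝ) T, ∀ x : Vec d, ‖x‖ ≤ R → ‖h (t, x)‖ ≤ P := by
  obtain ⟨P, hP⟩ := (isCompact_Icc (a := (0:ℝ)) (b := T)).prod
    (isCompact_closedBall (0 : Vec d) R) |>.exists_bound_of_continuousOn hh.continuousOn
  exact ⟨max P 0, le_max_right _ _, fun t ht x hx =>
    (hP (t, x) ⟨ht, by simpa using hx⟩).trans (le_max_left _ _)⟩

lemma C12.exists_lipschitz_bound (φ : C12 d) (T R : ℝ) :
    ∃ P, 0 ≤ P ∧ ∀ t ∈ Icc (0:ℝ) T, (∀ x, ‖x‖ ≤ R → ‖φ.grad t x‖ ≤ P) ∧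
      ∀ x y : Vec d, ‖x‖ ≤ R → ‖y‖ ≤ R → |φ.toFun t x - φ.toFun t y| ≤ P * ‖x - y‖ := by
  obtain ⟨P, hP0, hP⟩ := exists_forall_norm_le_of_continuous φ.cont_grad T R
  refine ⟨P, hP0, fun t ht => ⟨hP t ht, fun x y hx hy => ?_⟩⟩
  refine Convex.norm_image_sub_le_of_norm_hasFDerivWithin_le
    (s := closedBall (0 : Vec d) R)
    (fun z _ => (φ.hasGrad t z).hasFDerivAt.hasFDerivWithinAt) (fun z hz => ?_)
    (convex_closedBall _ _) (by simpa using hy) (by simpa using hx)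
  rw [LinearIsometryEquiv.norm_map]
  exact hP t ht z (by simpa using hz)

namespace AssumptionA

variable {ν : Measure (Vec n)} {A : Set (Vec m)} {T : ℝ}
  {b : Vec m → Vec d → Vec d} {σ : Vec m → Vec d → Matrix (Fin d) (Fin d) ℝ}
  {η : Vec m → Vec d → Vec n → Vec d} {γ : Vec d → Vec n → ℝ}
  {f : Vec m → ℝ → Vec d → ℝ → Vec d → ℝ → ℝ} {ζ : ℝ → Vec d → ℝ} {g : Vec d → ℝ} {C : ℝ}

lemma measure_lt_norm_lt_top (hA : AssumptionA ν A T b σ η γ f ζ g C) {ε : ℝ}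
    (hε : ε ∈ Ioo (0:ℝ) 1) : ν {e | ε < ‖e‖} < ⊤ := by
  refine (measure_mono fun e he => ?_).trans_lt
    (hA.hν_int.measure_ge_lt_top (ε := ε ^ 2) (pow_pos hε.1 2))
  exact le_min (pow_le_one₀ hε.1.le hε.2.le) (pow_le_pow_left₀ hε.1.le (le_of_lt he) 2)

lemma exists_dist_le (hA : AssumptionA ν A T b σ η γ f ζ g C) :
    ∃ D, 0 ≤ D ∧ ∀ α ∈ A, ∀ α' ∈ A, ‖α - α'‖ ≤ D :=
  ⟨diam A, diam_nonneg, fun α hα α' hα' => by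
    rw [← dist_eq_norm]; exact dist_le_diam_of_mem hA.hAcpt.isBounded hα hα'⟩

lemma norm_b_sub_le (hA : AssumptionA ν A T b σ η γ f ζ g C) {α α' : Vec m} (hα : α ∈ A)
    (hα' : α' ∈ A) (x : Vec d) : ‖b α x - b α' x‖ ≤ C * ‖α - α'‖ := by
  have h := hA.hb α hα α' hα' x x
  rw [sub_self, norm_zero, zero_add] at h
  linarith [norm_nonneg (σ α x - σ α' x)]

lemma abs_σ_sub_le (hA : AssumptionA ν A T b σ η γ f ζ g C) {α α' : Vec m} (hα : α ∈ A)
    (hα' : α' ∈ A) (x : Vec d) (i j : Fin d) : |σ α x i j - σ α' x i j| ≤ C * ‖α - α'‖ := by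
  have h := hA.hb α hα α' hα' x x
  rw [sub_self, norm_zero, zero_add] at h
  have h2 := Matrix.norm_entry_le_entrywise_sup_norm (σ α x - σ α' x) (i := i) (j := j)
  rw [Matrix.sub_apply, Real.norm_eq_abs] at h2
  linarith [norm_nonneg (b α x - b α' x)]

lemma exists_abs_σ_le (hA : AssumptionA ν A T b σ η γ f ζ g C) (R : ℝ) :
    ∃ S, 0 ≤ S ∧ ∀ α ∈ A, ∀ x : Vec d, ‖x‖ ≤ R → ∀ i j, |σ α x i j| ≤ S := by
  obtain ⟨α₀, hα₀⟩ := hA.hAne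
  obtain ⟨D, hD0, hD⟩ := hA.exists_dist_le
  refine ⟨‖σ α₀ 0‖ + C * (|R| + D),
    add_nonneg (norm_nonneg _) (mul_nonneg hA.hC.le (by positivity)), fun α hα x hx i j => ?_⟩
  have h1 : ‖σ α x - σ α₀ 0‖ ≤ C * (|R| + D) := by
    have h := hA.hb α hα α₀ hα₀ x 0
    have : C * (‖x - 0‖ + ‖α - α₀‖) ≤ C * (|R| + D) := by
      have := hA.hC.le
      gcongr
      · rw [sub_zero]; exact hx.trans (le_abs_self R)
      · exact hD α hα α₀ hα₀
    linarith [norm_nonneg (b α x - b α₀ 0)]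
  calc |σ α x i j| ≤ ‖σ α x‖ := Matrix.norm_entry_le_entrywise_sup_norm (σ α x)
    _ = ‖σ α₀ 0 + (σ α x - σ α₀ 0)‖ := by rw [add_sub_cancel]
    _ ≤ _ := (norm_add_le _ _).trans (by gcongr)

lemma norm_η_sub_le (hA : AssumptionA ν A T b σ η γ f ζ g C) {α α' : Vec m} (hα : α ∈ A)
    (hα' : α' ∈ A) (x : Vec d) (e : Vec n) :
    ‖η α x e - η α' x e‖ ≤ C * ‖α - α'‖ * min 1 ‖e‖ := by
  simpa using hA.hη_lip α hα α' hα' x x e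

lemma η_sq_le (hA : AssumptionA ν A T b σ η γ f ζ g C) {α : Vec m} (hα : α ∈ A)
    (x : Vec d) (e : Vec n) (i : Fin d) : (η α x e i) ^ 2 ≤ C ^ 2 * min 1 (‖e‖ ^ 2) := by
  have h := (PiLp.norm_apply_le (η α x e) i).trans (hA.hη_bdd α hα x e)
  calc (η α x e i) ^ 2 = ‖η α x e i‖ ^ 2 := by simp
    _ ≤ (C * min 1 ‖e‖) ^ 2 := by gcongr
    _ = C ^ 2 * (min 1 ‖e‖) ^ 2 := by ring
    _ ≤ _ := by gcongr; exact min_one_sq_le _ (norm_nonneg e)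

lemma integrable_η_sq (hA : AssumptionA ν A T b σ η γ f ζ g C) {α : Vec m} (hα : α ∈ A)
    (x : Vec d) (i : Fin d) : Integrable (fun e => (η α x e i) ^ 2) ν := by
  refine (hA.hν_int.const_mul (C ^ 2)).mono' ?_ (ae_of_all _ fun e => ?_)
  · have : Measurable fun e => η α x e i :=
      (show Continuous fun v : Vec d => v i by fun_prop).measurable.comp (hA.hη_meas α x)
    exact (this.pow_const 2).aestronglyMeasurable
  · rw [Real.norm_of_nonneg (sq_nonneg _)]
    exact hA.η_sq_le hα x e i

lemma abs_η_sq_sub_le (hA : AssumptionA ν A T b σ η γ f ζ g C) {α α' : Vec m} (hα : α ∈ A)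
    (hα' : α' ∈ A) (x : Vec d) (e : Vec n) (i : Fin d) :
    |(η α x e i) ^ 2 - (η α' x e i) ^ 2| ≤ 2 * C ^ 2 * ‖α - α'‖ * min 1 (‖e‖ ^ 2) := by
  have h1 := (PiLp.norm_apply_le (η α x e) i).trans (hA.hη_bdd α hα x e)
  have h2 := (PiLp.norm_apply_le (η α' x e) i).trans (hA.hη_bdd α' hα' x e)
  have h3 := (PiLp.norm_apply_le (η α x e - η α' x e) i).trans (hA.norm_η_sub_le hα hα' x e)
  rw [Real.norm_eq_abs] at h1 h2 h3
  have hC := hA.hC.le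
  have hm : 0 ≤ min 1 ‖e‖ := le_min zero_le_one (norm_nonneg e)
  calc |(η α x e i) ^ 2 - (η α' x e i) ^ 2|
      = |η α x e i + η α' x e i| * |η α x e i - η α' x e i| := by rw [← abs_mul, sq_sub_sq]
    _ ≤ (C * min 1 ‖e‖ + C * min 1 ‖e‖) * (C * ‖α - α'‖ * min 1 ‖e‖) := by
        gcongr
        · exact (abs_add_le _ _).trans (add_le_add h1 h2)
        · exact h3
    _ = 2 * C ^ 2 * ‖α - α'‖ * (min 1 ‖e‖) ^ 2 := by ring
    _ ≤ _ := by gcongr; exact min_one_sq_le _ (norm_nonneg e)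

lemma integral_min_nonneg : 0 ≤ ∫ e : Vec n, min 1 (‖e‖ ^ 2) ∂ν :=
  integral_nonneg fun _ => le_min zero_le_one (sq_nonneg _)

lemma setIntegral_η_sq_le (hA : AssumptionA ν A T b σ η γ f ζ g C) {α : Vec m} (hα : α ∈ A)
    (x : Vec d) (i : Fin d) (s : Set (Vec n)) :
    ∫ e in s, (η α x e i) ^ 2 ∂ν ≤ C ^ 2 * ∫ e, min 1 (‖e‖ ^ 2) ∂ν := by
  rw [← integral_const_mul]
  exact (setIntegral_le_integral (hA.integrable_η_sq hα x i)
    (ae_of_all _ fun e => sq_nonneg _)).trans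
    (integral_mono (hA.integrable_η_sq hα x i) (hA.hν_int.const_mul _)
      fun e => hA.η_sq_le hα x e i)

lemma abs_setIntegral_η_sq_sub_le (hA : AssumptionA ν A T b σ η γ f ζ g C) {α α' : Vec m}
    (hα : α ∈ A) (hα' : α' ∈ A) (x : Vec d) (i : Fin d) (s : Set (Vec n)) :
    |(∫ e in s, (η α x e i) ^ 2 ∂ν) - ∫ e in s, (η α' x e i) ^ 2 ∂ν|
      ≤ 2 * C ^ 2 * ‖α - α'‖ * ∫ e, min 1 (‖e‖ ^ 2) ∂ν := by
  have hC := hA.hC.le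
  rw [← integral_sub (hA.integrable_η_sq hα x i).integrableOn
    (hA.integrable_η_sq hα' x i).integrableOn]
  refine (norm_integral_le_of_norm_le
    (f := fun e => (η α x e i) ^ 2 - (η α' x e i) ^ 2)
    (hA.hν_int.const_mul (2 * C ^ 2 * ‖α - α'‖)).integrableOn
    (ae_of_all _ fun e => hA.abs_η_sq_sub_le hα hα' x e i)).trans ?_
  rw [← integral_const_mul]
  refine setIntegral_le_integral (hA.hν_int.const_mul _) (ae_of_all _ fun e => ?_)
  exact mul_nonneg (by positivity) (le_min zero_le_one (sq_nonneg _))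

lemma exists_abs_sigmaTilde_le (hA : AssumptionA ν A T b σ η γ f ζ g C) (ε R : ℝ) :
    ∃ S, 0 ≤ S ∧ ∀ α ∈ A, ∀ x : Vec d, ‖x‖ ≤ R → ∀ i j, |sigmaTilde ν σ η ε α x i j| ≤ S := by
  obtain ⟨S, hS0, hS⟩ := hA.exists_abs_σ_le R
  have hI := integral_min_nonneg (ν := ν)
  refine ⟨√(S ^ 2 + C ^ 2 * ∫ e, min 1 (‖e‖ ^ 2) ∂ν), Real.sqrt_nonneg _,
    fun α hα x hx i j => ?_⟩
  rw [sigmaTilde, Matrix.of_apply]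
  split_ifs
  · rw [abs_of_nonneg (Real.sqrt_nonneg _)]
    refine Real.sqrt_le_sqrt (add_le_add ?_ (hA.setIntegral_η_sq_le hα x i _))
    rw [← sq_abs]
    exact pow_le_pow_left₀ (abs_nonneg _) (hS α hα x hx i i) 2
  · refine Real.le_sqrt_of_sq_le ?_
    have := pow_le_pow_left₀ (abs_nonneg _) (hS α hα x hx i j) 2
    have := mul_nonneg (sq_nonneg C) hI
    linarith

lemma exists_abs_sigmaTilde_sub_le (hA : AssumptionA ν A T b σ η γ f ζ g C) (ε R : ℝ) :
    ∃ S, 0 ≤ S ∧ ∀ α ∈ A, ∀ α' ∈ A, ∀ x : Vec d, ‖x‖ ≤ R → ∀ i j,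
      |sigmaTilde ν σ η ε α x i j - sigmaTilde ν σ η ε α' x i j| ≤ S * √‖α - α'‖ := by
  obtain ⟨S, hS0, hS⟩ := hA.exists_abs_σ_le R
  obtain ⟨D, hD0, hD⟩ := hA.exists_dist_le
  have hC := hA.hC.le
  set I := ∫ e : Vec n, min 1 (‖e‖ ^ 2) ∂ν
  have hI : 0 ≤ I := integral_min_nonneg (ν := ν)
  refine ⟨√(2 * S * C + 2 * C ^ 2 * I) + C * √D, by positivity,
    fun α hα α' hα' x hx i j => ?_⟩
  rw [sigmaTilde, sigmaTilde, Matrix.of_apply, Matrix.of_apply, add_mul]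
  split_ifs
  · refine (abs_sqrt_sub_sqrt_le_sqrt_abs_sub
      (add_nonneg (sq_nonneg _) (integral_nonneg fun e => sq_nonneg _))
      (add_nonneg (sq_nonneg _) (integral_nonneg fun e => sq_nonneg _))).trans ?_
    refine le_trans ?_ (le_add_of_nonneg_right (by positivity))
    rw [← Real.sqrt_mul (by positivity)]
    refine Real.sqrt_le_sqrt ?_
    have h1 := hA.abs_setIntegral_η_sq_sub_le hα hα' x i {e | ‖e‖ < ε}
    have h2 : |σ α x i i ^ 2 - σ α' x i i ^ 2| ≤ (S + S) * (C * ‖α - α'‖) := by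
      rw [sq_sub_sq, abs_mul]
      gcongr
      · exact (abs_add_le _ _).trans (add_le_add (hS α hα x hx i i) (hS α' hα' x hx i i))
      · exact hA.abs_σ_sub_le hα hα' x i i
    rw [add_sub_add_comm]
    refine (abs_add_le _ _).trans ((add_le_add h2 h1).trans_eq ?_)
    ring
  · refine (hA.abs_σ_sub_le hα hα' x i j).trans
      (le_trans ?_ (le_add_of_nonneg_left (by positivity)))
    rw [mul_assoc, ← Real.sqrt_mul hD0]
    gcongr
    refine Real.le_sqrt_of_sq_le ?_
    rw [sq]
    gcongr
    exact hD α hα α' hα'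

lemma norm_add_η_le (hA : AssumptionA ν A T b σ η γ f ζ g C) {α : Vec m} (hα : α ∈ A)
    {R : ℝ} {x : Vec d} (hx : ‖x‖ ≤ R) (e : Vec n) : ‖x + η α x e‖ ≤ R + C := by
  have h : ‖η α x e‖ ≤ C :=
    (hA.hη_bdd α hα x e).trans (mul_le_of_le_one_right hA.hC.le (min_le_left _ _))
  exact (norm_add_le _ _).trans (add_le_add hx h)

lemma norm_η_sub_le' (hA : AssumptionA ν A T b σ η γ f ζ g C) {α α' : Vec m} (hα : α ∈ A)
    (hα' : α' ∈ A) (x : Vec d) (e : Vec n) : ‖η α x e - η α' x e‖ ≤ C * ‖α - α'‖ :=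
  (hA.norm_η_sub_le hα hα' x e).trans
    (mul_le_of_le_one_right (mul_nonneg hA.hC.le (norm_nonneg _)) (min_le_left _ _))

lemma measurable_toFun_add_η (hA : AssumptionA ν A T b σ η γ f ζ g C) (φ : C12 d)
    (α : Vec m) (t : ℝ) (x : Vec d) : Measurable fun e => φ.toFun t (x + η α x e) :=
  (φ.cont.comp (Continuous.prodMk_right t)).measurable.comp ((hA.hη_meas α x).const_add x)

lemma exists_abs_Ktr_sub_le (hA : AssumptionA ν A T b σ η γ f ζ g C) {ε : ℝ}
    (hε : ε ∈ Ioo (0:ℝ) 1) (φ : C12 d) (R : ℝ) :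
    ∃ M, 0 ≤ M ∧ ∀ α ∈ A, ∀ α' ∈ A, ∀ t ∈ Icc (0:ℝ) T, ∀ x : Vec d, ‖x‖ ≤ R →
      |Ktr ν η ε φ α t x - Ktr ν η ε φ α' t x| ≤ M * ‖α - α'‖ := by
  have hC := hA.hC.le
  obtain ⟨P, hP0, hP⟩ := φ.exists_lipschitz_bound T (R + C)
  have : Fact (ν {e | ε < ‖e‖} < ⊤) := ⟨hA.measure_lt_norm_lt_top hε⟩
  set μ := ν.restrict {e : Vec n | ε < ‖e‖}
  refine ⟨2 * P * C * μ.real univ, by positivity, fun α hα α' hα' t ht x hx => ?_⟩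
  have hxR : ‖x‖ ≤ R + C := hx.trans (le_add_of_nonneg_right hC)
  have hgrad : ‖φ.grad t x‖ ≤ P := (hP t ht).1 x hxR
  have hint : ∀ β ∈ A, Integrable
      (fun e => φ.toFun t (x + η β x e) - φ.toFun t x - ⟪η β x e, φ.grad t x⟫) μ := by
    intro β hβ
    refine Integrable.of_bound (C := P * C + C * P) ?_ (ae_of_all _ fun e => ?_)
    · exact (((hA.measurable_toFun_add_η φ β t x).sub_const _).sub
        ((hA.hη_meas β x).inner measurable_const)).aestronglyMeasurable
    · have hη : ‖η β x e‖ ≤ C :=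
        (hA.hη_bdd β hβ x e).trans (mul_le_of_le_one_right hC (min_le_left _ _))
      refine (norm_sub_le _ _).trans (add_le_add ?_ ?_)
      · refine ((hP t ht).2 _ _ (hA.norm_add_η_le hβ hx e) hxR).trans ?_
        rw [add_sub_cancel_left]
        gcongr
      · exact (norm_inner_le_norm _ _).trans (by gcongr)
  rw [Ktr, Ktr, Kop, Kop, ← integral_sub (hint α hα) (hint α' hα')]
  have hbound : ∀ᵐ e ∂μ, ‖(φ.toFun t (x + η α x e) - φ.toFun t x - ⟪η α x e, φ.grad t x⟫)
      - (φ.toFun t (x + η α' x e) - φ.toFun t x - ⟪η α' x e, φ.grad t x⟫)‖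
      ≤ 2 * P * C * ‖α - α'‖ := by
    refine ae_of_all _ fun e => ?_
    have h := hA.norm_η_sub_le' hα hα' x e
    have h1 : |φ.toFun t (x + η α x e) - φ.toFun t (x + η α' x e)| ≤ P * (C * ‖α - α'‖) := by
      refine ((hP t ht).2 _ _ (hA.norm_add_η_le hα hx e) (hA.norm_add_η_le hα' hx e)).trans ?_
      rw [add_sub_add_left_eq_sub]
      gcongr
    have h2 : |⟪η α x e - η α' x e, φ.grad t x⟫| ≤ C * ‖α - α'‖ * P :=
      (abs_real_inner_le_norm _ _).trans (by gcongr)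
    have e1 : (φ.toFun t (x + η α x e) - φ.toFun t x - ⟪η α x e, φ.grad t x⟫)
      - (φ.toFun t (x + η α' x e) - φ.toFun t x - ⟪η α' x e, φ.grad t x⟫)
      = (φ.toFun t (x + η α x e) - φ.toFun t (x + η α' x e))
        - ⟪η α x e - η α' x e, φ.grad t x⟫ := by rw [inner_sub_left]; ring
    rw [e1]
    refine (norm_sub_le _ _).trans ((add_le_add h1 h2).trans_eq ?_)
    ring
  refine (norm_integral_le_of_norm_le_const hbound).trans_eq ?_
  ring

lemma exists_abs_Btr_sub_le (hA : AssumptionA ν A T b σ η γ f ζ g C) {ε : ℝ}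
    (hε : ε ∈ Ioo (0:ℝ) 1) (φ : C12 d) (R : ℝ) :
    ∃ M, 0 ≤ M ∧ ∀ α ∈ A, ∀ α' ∈ A, ∀ t ∈ Icc (0:ℝ) T, ∀ x : Vec d, ‖x‖ ≤ R →
      |Btr ν η γ ε φ α t x - Btr ν η γ ε φ α' t x| ≤ M * ‖α - α'‖ := by
  have hC := hA.hC.le
  obtain ⟨P, hP0, hP⟩ := φ.exists_lipschitz_bound T (R + C)
  have : Fact (ν {e | ε < ‖e‖} < ⊤) := ⟨hA.measure_lt_norm_lt_top hε⟩
  set μ := ν.restrict {e : Vec n | ε < ‖e‖}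
  refine ⟨P * C * C * μ.real univ, by positivity, fun α hα α' hα' t ht x hx => ?_⟩
  have hxR : ‖x‖ ≤ R + C := hx.trans (le_add_of_nonneg_right hC)
  have hγ : ∀ e, ‖γ x e‖ ≤ C := fun e => by
    rw [Real.norm_of_nonneg (hA.hγ_nonneg x e)]
    exact (hA.hγ_bdd x e).trans (mul_le_of_le_one_right hC (min_le_left _ _))
  have hint : ∀ β ∈ A, Integrable
      (fun e => (φ.toFun t (x + η β x e) - φ.toFun t x) * γ x e) μ := by
    intro β hβ
    refine Integrable.of_bound (C := P * C * C) ?_ (ae_of_all _ fun e => ?_)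
    · exact (((hA.measurable_toFun_add_η φ β t x).sub_const _).mul
        (hA.hγ_meas x)).aestronglyMeasurable
    · have hη : ‖η β x e‖ ≤ C :=
        (hA.hη_bdd β hβ x e).trans (mul_le_of_le_one_right hC (min_le_left _ _))
      rw [norm_mul]
      gcongr
      · refine ((hP t ht).2 _ _ (hA.norm_add_η_le hβ hx e) hxR).trans ?_
        rw [add_sub_cancel_left]
        gcongr
      · exact hγ e
  rw [Btr, Btr, Bop, Bop, ← integral_sub (hint α hα) (hint α' hα')]
  have hbound : ∀ᵐ e ∂μ, ‖(φ.toFun t (x + η α x e) - φ.toFun t x) * γ x e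
      - (φ.toFun t (x + η α' x e) - φ.toFun t x) * γ x e‖ ≤ P * (C * ‖α - α'‖) * C := by
    refine ae_of_all _ fun e => ?_
    rw [← sub_mul, sub_sub_sub_cancel_right, norm_mul]
    gcongr
    · refine ((hP t ht).2 _ _ (hA.norm_add_η_le hα hx e) (hA.norm_add_η_le hα' hx e)).trans ?_
      rw [add_sub_add_left_eq_sub]
      gcongr
      exact hA.norm_η_sub_le' hα hα' x e
    · exact hγ e
  refine (norm_integral_le_of_norm_le_const hbound).trans_eq ?_
  ring

/-- The truncated Hamiltonian is `1/2`-Hölder in the control, locally uniformly in `(t, x)`. -/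
lemma exists_abs_hamiltonian_sub_le (hA : AssumptionA ν A T b σ η γ f ζ g C) {ε : ℝ}
    (hε : ε ∈ Ioo (0:ℝ) 1) (φ : C12 d) (R : ℝ) :
    ∃ M, 0 ≤ M ∧ ∀ x : Vec d, ‖x‖ ≤ R → ∀ t ∈ Icc (0:ℝ) T, ∀ α ∈ A, ∀ α' ∈ A, ∀ u : ℝ,
      |(-(Ltr ν b σ η ε φ α t x) - f α t x u
          (mvE ((sigmaTilde ν σ η ε α x)ᵀ) (φ.grad t x)) (Btr ν η γ ε φ α t x))
        - (-(Ltr ν b σ η ε φ α' t x) - f α' t x u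
          (mvE ((sigmaTilde ν σ η ε α' x)ᵀ) (φ.grad t x)) (Btr ν η γ ε φ α' t x))|
        ≤ M * √‖α - α'‖ := by
  have hC := hA.hC.le
  obtain ⟨D, hD0, hD⟩ := hA.exists_dist_le
  obtain ⟨P, hP0, hP⟩ := exists_forall_norm_le_of_continuous φ.cont_grad T R
  obtain ⟨Q, hQ0, hQ⟩ := exists_forall_norm_le_of_continuous φ.cont_hess T R
  obtain ⟨S, hS0, hS⟩ := hA.exists_abs_sigmaTilde_le ε R
  obtain ⟨S', hS'0, hS'⟩ := hA.exists_abs_sigmaTilde_sub_le ε R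
  obtain ⟨MK, hMK0, hMK⟩ := hA.exists_abs_Ktr_sub_le hε φ R
  obtain ⟨MB, hMB0, hMB⟩ := hA.exists_abs_Btr_sub_le hε φ R
  refine ⟨d ^ 3 * (2 * S * S' * Q) + C * √D * P + MK * √D
    + C * (√D + d ^ 2 * (S' * P) + MB * √D), by positivity, fun x hx t ht α hα α' hα' u => ?_⟩
  set s := √‖α - α'‖
  have hs0 : 0 ≤ s := Real.sqrt_nonneg _
  have hs : ‖α - α'‖ ≤ √D * s := by
    rw [← Real.sqrt_mul hD0]
    refine Real.le_sqrt_of_sq_le ?_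
    rw [sq]
    gcongr
    exact hD α hα α' hα'
  have htr := abs_trace_mul_transpose_mul_sub_le (hS α hα x hx) (hS α' hα' x hx)
    (hS' α hα α' hα' x hx) (H := φ.hess t x) (Q := Q) fun i j =>
      (Matrix.norm_entry_le_entrywise_sup_norm (φ.hess t x)).trans (hQ t ht x hx)
  have hbd : |⟪b α x, φ.grad t x⟫ - ⟪b α' x, φ.grad t x⟫| ≤ C * (√D * s) * P := by
    rw [← inner_sub_left]
    refine (abs_real_inner_le_norm _ _).trans ?_
    gcongr
    · exact (hA.norm_b_sub_le hα hα' x).trans (by gcongr)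
    · exact hP t ht x hx
  have hK : |Ktr ν η ε φ α t x - Ktr ν η ε φ α' t x| ≤ MK * (√D * s) :=
    (hMK α hα α' hα' t ht x hx).trans (by gcongr)
  have hB : |Btr ν η γ ε φ α t x - Btr ν η γ ε φ α' t x| ≤ MB * (√D * s) :=
    (hMB α hα α' hα' t ht x hx).trans (by gcongr)
  have hmv : ‖mvE ((sigmaTilde ν σ η ε α x)ᵀ) (φ.grad t x)
      - mvE ((sigmaTilde ν σ η ε α' x)ᵀ) (φ.grad t x)‖ ≤ d ^ 2 * (S' * s * P) := by
    refine (norm_mvE_sub_le (D := S' * s) (fun i j => hS' α hα α' hα' x hx j i) _).trans ?_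
    gcongr
    exact hP t ht x hx
  have hf := hA.hf_lip α hα α' hα' t ht x u u
    (mvE ((sigmaTilde ν σ η ε α x)ᵀ) (φ.grad t x))
    (mvE ((sigmaTilde ν σ η ε α' x)ᵀ) (φ.grad t x))
    (Btr ν η γ ε φ α t x) (Btr ν η γ ε φ α' t x)
  have hf' := hf.trans (mul_le_mul_of_nonneg_left
    (add_le_add (add_le_add (add_le_add hs (by rw [sub_self, abs_zero])) hmv) hB) hC)
  simp only [Ltr]
  rw [abs_le] at *
  constructor <;> linarith [htr.1, htr.2, hbd.1, hbd.2, hK.1, hK.2, hf'.1, hf'.2]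

end AssumptionA

/-- Consistency of the control discretization (Lemma 3.1). -/
theorem control_discretization_consistency
    {n d m : ℕ} (ν : Measure (Vec n)) (A : Set (Vec m)) (T : ℝ)
    (b : Vec m → Vec d → Vec d) (σ : Vec m → Vec d → Matrix (Fin d) (Fin d) ℝ)
    (η : Vec m → Vec d → Vec n → Vec d) (γ : Vec d → Vec n → ℝ)
    (f : Vec m → ℝ → Vec d → ℝ → Vec d → ℝ → ℝ)
    (ζ : ℝ → Vec d → ℝ) (g : Vec d → ℝ) (C : ℝ)
    (hA : AssumptionA ν A T b σ η γ f ζ g C)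
    (ε : ℝ) (hε : ε ∈ Ioo (0:ℝ) 1)
    (φ : C12 d)
    (Aδ : ℝ → Set (Vec m))
    (hAδ_fin : ∀ δ ∈ Ioc (0:ℝ) 1, (Aδ δ).Finite)
    (hAδ_ne : ∀ δ ∈ Ioc (0:ℝ) 1, (Aδ δ).Nonempty)
    (hAδ_sub : ∀ δ ∈ Ioc (0:ℝ) 1, Aδ δ ⊆ A)
    (hAδ_dense : ∀ δ ∈ Ioc (0:ℝ) 1, ∀ α ∈ A, ∃ α' ∈ Aδ δ, ‖α - α'‖ < δ) :
    ∃ ω₁ : (ℝ × Vec d) → ℝ → ℝ, ∃ ω₂ : ℝ → ℝ,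
      (∀ ξ δ, 0 ≤ ω₁ ξ δ) ∧
      (∀ ξ : ℝ × Vec d, ξ ∈ Ioc (0:ℝ) T ×ˢ (univ : Set (Vec d)) →
        Tendsto (fun δ => ω₁ ξ δ) (nhdsWithin 0 (Ioi (0:ℝ))) (nhds 0)) ∧
      (∀ r, 0 ≤ ω₂ r) ∧ Tendsto ω₂ (nhds 0) (nhds 0) ∧
      (∀ K : Set (ℝ × Vec d), IsCompact K → K ⊆ Ioc (0:ℝ) T ×ˢ (univ : Set (Vec d)) →
        ∃ L : NNReal, ∀ δ ∈ Ioc (0:ℝ) 1, LipschitzOnWith L (fun ξ => ω₁ ξ δ) K) ∧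
      (∀ t ∈ Ioc (0:ℝ) T, ∀ x : Vec d, ∀ δ ∈ Ioc (0:ℝ) 1, ∀ r : ℝ,
        |Fop ν A b σ η γ f ζ ε φ 0 t x - Fop ν (Aδ δ) b σ η γ f ζ ε φ r t x|
          ≤ ω₁ (t, x) δ + ω₂ r) := by
  have hC := hA.hC.le
  set Hm : Vec m → ℝ → Vec d → ℝ → ℝ := fun α t x u => -(Ltr ν b σ η ε φ α t x) - f α t x u
    (mvE ((sigmaTilde ν σ η ε α x)ᵀ) (φ.grad t x)) (Btr ν η γ ε φ α t x) with hHm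
  obtain ⟨W, hWlip, hW⟩ := exists_locallyLipschitz_forall_mem
    (t := fun x : Vec d => {M : ℝ | 0 ≤ M ∧ ∀ t ∈ Icc (0:ℝ) T, ∀ α ∈ A, ∀ α' ∈ A, ∀ u : ℝ,
      |Hm α t x u - Hm α' t x u| ≤ M * √‖α - α'‖})
    (fun x M hM M' hM' a c ha hc hac => by
      refine ⟨add_nonneg (mul_nonneg ha hM.1) (mul_nonneg hc hM'.1),
        fun t ht α hα α' hα' u => ?_⟩
      have h1 := mul_le_mul_of_nonneg_left (hM.2 t ht α hα α' hα' u) ha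
      have h2 := mul_le_mul_of_nonneg_left (hM'.2 t ht α hα α' hα' u) hc
      calc |Hm α t x u - Hm α' t x u|
          = a * |Hm α t x u - Hm α' t x u| + c * |Hm α t x u - Hm α' t x u| := by
            rw [← add_mul, hac, one_mul]
        _ ≤ _ := add_le_add h1 h2
        _ = _ := by simp only [smul_eq_mul]; ring)
    (fun R =>
      let ⟨M, hM0, hM⟩ := hA.exists_abs_hamiltonian_sub_le hε φ R
      ⟨M, fun x hx => ⟨hM0, hM x hx⟩⟩)
  refine ⟨fun ξ δ => W ξ.2 * √δ, fun r => (1 + C) * |r|,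
    fun ξ δ => mul_nonneg (hW ξ.2).1 (Real.sqrt_nonneg δ), fun ξ _ => ?_,
    fun r => by positivity, ?_, fun K hK _ => ?_, fun t ht x δ hδ r => ?_⟩
  · have h : Continuous fun δ : ℝ => W ξ.2 * √δ := by fun_prop
    simpa using (h.tendsto 0).mono_left nhdsWithin_le_nhds
  · have h : Continuous fun r : ℝ => (1 + C) * |r| := by fun_prop
    simpa using h.tendsto 0
  · obtain ⟨L, hL⟩ :=
      (hWlip.locallyLipschitzOn (s := Prod.snd '' K)).exists_lipschitzOnWith_of_compact
        (hK.image continuous_snd)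
    refine ⟨L, fun δ hδ => LipschitzOnWith.of_dist_le_mul fun ξ hξ ξ' hξ' => ?_⟩
    have h1 := hL.dist_le_mul ξ.2 (mem_image_of_mem _ hξ) ξ'.2 (mem_image_of_mem _ hξ')
    have h2 : √δ ≤ 1 := Real.sqrt_le_one.2 hδ.2
    rw [Real.dist_eq, ← sub_mul, abs_mul, abs_of_nonneg (Real.sqrt_nonneg δ), ← Real.dist_eq]
    calc dist (W ξ.2) (W ξ'.2) * √δ ≤ dist (W ξ.2) (W ξ'.2) :=
          mul_le_of_le_one_right dist_nonneg h2
      _ ≤ L * dist ξ.2 ξ'.2 := h1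
      _ ≤ L * dist ξ ξ' := by gcongr; exact le_max_right _ _
  · have ht' : t ∈ Icc (0:ℝ) T := ⟨ht.1.le, ht.2⟩
    obtain ⟨hW0, hWx⟩ := hW x
    obtain ⟨D, -, hD⟩ := hA.exists_dist_le
    obtain ⟨α₀, hα₀⟩ := hA.hAne
    have hu : ∀ α ∈ A, |Hm α t x (φ.toFun t x + 0) - Hm α t x (φ.toFun t x + r)| ≤ C * |r| := by
      intro α hα
      have h := hA.hf_lip α hα α hα t ht' x (φ.toFun t x + r) (φ.toFun t x + 0)
        (mvE ((sigmaTilde ν σ η ε α x)ᵀ) (φ.grad t x))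
        (mvE ((sigmaTilde ν σ η ε α x)ᵀ) (φ.grad t x))
        (Btr ν η γ ε φ α t x) (Btr ν η γ ε φ α t x)
      simp only [sub_self, norm_zero, abs_zero, add_zero, zero_add, add_sub_cancel_left] at h
      simpa only [hHm, sub_sub_sub_cancel_left, add_zero] using h
    have hω : 0 ≤ W x * √δ := mul_nonneg hW0 (Real.sqrt_nonneg δ)
    have hinf := abs_iInf_sub_iInf_le (h := fun α => Hm α t x (φ.toFun t x + 0))
      (h' := fun α => Hm α t x (φ.toFun t x + r)) (c := W x * √δ + C * |r|)
      (B := Hm α₀ t x (φ.toFun t x + 0) - W x * √D) (hAδ_ne δ hδ) (hAδ_sub δ hδ)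
      (fun α hα => by
        have h1 := (abs_le.1 (hWx t ht' α₀ hα₀ α hα (φ.toFun t x + 0))).2
        have h2 : W x * √‖α₀ - α‖ ≤ W x * √D := by gcongr; exact hD α₀ hα₀ α hα
        linarith)
      (fun α hα => (hu α (hAδ_sub δ hδ hα)).trans (le_add_of_nonneg_left hω))
      (fun α hα => by
        obtain ⟨α', hα', hαα'⟩ := hAδ_dense δ hδ α hα
        have hα'A := hAδ_sub δ hδ hα'
        refine ⟨α', hα', (abs_sub_le _ (Hm α' t x (φ.toFun t x + 0)) _).trans
          (add_le_add ((hWx t ht' α hα α' hα'A _).trans ?_) (hu α' hα'A))⟩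
        gcongr)
    refine (abs_min_sub_min_le_max _ _ _ _).trans (max_le ?_ ?_)
    · have e : φ.toFun t x + 0 - ζ t x - (φ.toFun t x + r - ζ t x) = -r := by ring
      rw [e, abs_neg]
      have := mul_nonneg hC (abs_nonneg r)
      dsimp only
      linarith
    · rw [add_sub_add_left_eq_sub]
      refine hinf.trans ?_
      dsimp only
      linarith [abs_nonneg r]
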